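/- arXiv:1908.10056 — 4 statements merged into one kernel-verified Lean document; each statement's English description precedes it below -/
import Mathlib

section
/- (Lemma 1, determinant form.) Given ρ > 0, matrices H_n ∈ ℂ^{m_n×K} and vectors w_n ∈ ℂ^{m_n} for n = 1,…,N, define G_n = H_n^H w_n w_n^H H_n, Q_0 = I_K, Q_n = Q_{n−1} + ρ G_n, and T_n = H_n Q_{n−1}^{−1} H_n^H. Then det(I_K + ρ Σ_{n=1}^{N} G_n) = Π_{n=1}^{N} (1 + ρ · w_n^H T_n w_n). -/
open Matrix

/-- The matrix determinant lemma for the rank-one update `A + c Bᴴ x xᴴ B`. -/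
theorem det_add_smul_conjTranspose_mul_vecMulVec_mul {k l : Type*} [Fintype k] [DecidableEq k]
    [Fintype l] (c : ℂ) (B : Matrix l k ℂ) (x : l → ℂ) {A : Matrix k k ℂ} (hA : IsUnit A.det) :
    (A + c • (Bᴴ * vecMulVec x (star x) * B)).det =
      A.det * (1 + c * (star x ⬝ᵥ ((B * A⁻¹ * Bᴴ) *ᵥ x))) := by
  have hG : c • (Bᴴ * vecMulVec x (star x) * B) =
      replicateCol Unit (c • Bᴴ *ᵥ x) * replicateRow Unit (star x ᵥ* B) := by
    rw [← vecMulVec_eq Unit, mul_vecMulVec, vecMulVec_mul, smul_vecMulVec]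
  rw [hG, det_add_replicateCol_mul_replicateRow hA, det_unique (n := Unit), Matrix.add_apply,
    one_apply_eq, ← replicateRow_vecMul, replicateRow_mul_replicateCol_apply, dotProduct_smul,
    smul_eq_mul, dotProduct_mulVec, dotProduct_mulVec]
  simp only [vecMul_vecMul, Matrix.mul_assoc]

open scoped ComplexOrder in
theorem posSemidef_conjTranspose_mul_vecMulVec_mul {k l : Type*} [Fintype k] [Fintype l]
    (B : Matrix l k ℂ) (x : l → ℂ) : (Bᴴ * vecMulVec x (star x) * B).PosSemidef :=
  (posSemidef_vecMulVec_self_star x).conjTranspose_mul_mul_same B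

open scoped ComplexOrder in
/-- Accumulated rank-one updates of the identity stay positive definite, and their determinant
is the product of the factors from the matrix determinant lemma. -/
theorem posDef_and_eq_and_det_of_update {K N : ℕ} (ρ : ℝ) (hρ : 0 < ρ) (m : Fin N → ℕ)
    (H : (n : Fin N) → Matrix (Fin (m n)) (Fin K) ℂ)
    (w : (n : Fin N) → Fin (m n) → ℂ)
    (Q : ℕ → Matrix (Fin K) (Fin K) ℂ)
    (hQ0 : Q 0 = 1)
    (hQ : ∀ n : Fin N, Q (n.val + 1) =
      Q n.val + (ρ : ℂ) • ((H n)ᴴ * vecMulVec (w n) (star (w n)) * H n)) :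
    (Q N).PosDef ∧
      Q N = 1 + (ρ : ℂ) • ∑ n : Fin N, (H n)ᴴ * vecMulVec (w n) (star (w n)) * H n ∧
      (Q N).det = ∏ n : Fin N,
        (1 + (ρ : ℂ) * (star (w n) ⬝ᵥ ((H n * (Q n.val)⁻¹ * (H n)ᴴ) *ᵥ w n))) := by
  induction N with
  | zero => simpa [hQ0] using PosDef.one
  | succ N ih =>
    obtain ⟨hpos, hsum, hdet⟩ := ih (fun n => m n.castSucc) (fun n => H n.castSucc)
      (fun n => w n.castSucc) (fun n => hQ n.castSucc)
    have hlast := hQ (Fin.last N)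
    rw [Fin.val_last] at hlast
    refine ⟨?_, ?_, ?_⟩
    · rw [hlast]
      exact hpos.add_posSemidef ((posSemidef_conjTranspose_mul_vecMulVec_mul _ _).smul
        (by exact_mod_cast hρ.le))
    · rw [hlast, Fin.sum_univ_castSucc, smul_add, ← add_assoc, ← hsum]
    · rw [hlast, det_add_smul_conjTranspose_mul_vecMulVec_mul _ _ _
        ((isUnit_iff_isUnit_det _).mp hpos.isUnit), Fin.prod_univ_castSucc, hdet]
      rfl

/-- (Lemma 1, determinant form.) Given `ρ > 0`, matrices
`H n ∈ ℂ^{m n × K}` and vectors `w n ∈ ℂ^{m n}`, with `G n = (H n)ᴴ w_n w_nᴴ (H n)`,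
`Q 0 = I_K`, `Q (n+1) = Q n + ρ G n`, and `T n = H n (Q n)⁻¹ (H n)ᴴ`, one has
`det(I_K + ρ ∑ₙ G n) = ∏ₙ (1 + ρ wₙᴴ (T n) wₙ)`. (0-based indexing.) -/
theorem stmt3 {K N : ℕ} (ρ : ℝ) (hρ : 0 < ρ) (m : Fin N → ℕ)
    (H : (n : Fin N) → Matrix (Fin (m n)) (Fin K) ℂ)
    (w : (n : Fin N) → Fin (m n) → ℂ)
    (Q : ℕ → Matrix (Fin K) (Fin K) ℂ)
    (hQ0 : Q 0 = 1)
    (hQ : ∀ n : Fin N, Q (n.val + 1) =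
      Q n.val + (ρ : ℂ) • ((H n)ᴴ * Matrix.vecMulVec (w n) (star (w n)) * H n)) :
    Matrix.det
        (1 + (ρ : ℂ) •
          ∑ n : Fin N, (H n)ᴴ * Matrix.vecMulVec (w n) (star (w n)) * H n) =
      ∏ n : Fin N,
        (1 + (ρ : ℂ) *
          (star (w n) ⬝ᵥ ((H n * (Q n.val)⁻¹ * (H n)ᴴ) *ᵥ w n))) := by
  obtain ⟨-, hsum, hdet⟩ := posDef_and_eq_and_det_of_update ρ hρ m H w Q hQ0 hQ
  rw [← hsum, hdet]
end

section
/- (Lemma 1.) Given ρ > 0, matrices H_n ∈ ℂ^{m_n×K} and vectors w_n ∈ ℂ^{m_n} for n = 1,…,N, define G_n = H_n^H w_n w_n^H H_n, Q_0 = I_K, Q_n = Q_{n−1} + ρ G_n, and T_n = H_n Q_{n−1}^{−1} H_n^H. Then each scalar w_n^H T_n w_n is a nonnegative real number, det(I_K + ρ Σ_{n=1}^{N} G_n) is a real number ≥ 1, and the total achievable rate factorizes into the sum of N sub-rates: log₂ Re(det(I_K + ρ Σ_{n=1}^{N} G_n)) = Σ_{n=1}^{N} log₂(1 + ρ · Re(w_n^H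 T_n w_n)). -/
open Matrix

open scoped ComplexOrder

section RankOneUpdates

variable {ι : Type*}

lemma conjTranspose_mul_vecMulVec_star_mul {κ : Type*} [Fintype κ]
    (A : Matrix κ ι ℂ) (w : κ → ℂ) :
    Aᴴ * vecMulVec w (star w) * A = vecMulVec (Aᴴ *ᵥ w) (star (Aᴴ *ᵥ w)) := by
  rw [mul_vecMulVec, vecMulVec_mul, star_mulVec, conjTranspose_conjTranspose]

lemma eq_one_add_sum_of_rankOne_updates [DecidableEq ι] {ρ : ℝ} {Q : ℕ → Matrix ι ι ℂ}
    (hQ0 : Q 0 = 1) {N : ℕ} (u : Fin N → ι → ℂ)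
    (hQ : ∀ n : Fin N, Q (n.val + 1) = Q n.val + (ρ : ℂ) • vecMulVec (u n) (star (u n))) :
    Q N = 1 + (ρ : ℂ) • ∑ n, vecMulVec (u n) (star (u n)) := by
  induction N with
  | zero => simp [hQ0]
  | succ N ih =>
    have hlast := hQ (Fin.last N)
    rw [Fin.val_last] at hlast
    rw [hlast, ih (fun n => u n.castSucc) fun n => hQ n.castSucc, Fin.sum_univ_castSucc, smul_add,
      add_assoc]

variable [Fintype ι]

lemma star_dotProduct_mul_mul_conjTranspose_mulVec {κ : Type*} [Fintype κ]
    (A : Matrix κ ι ℂ) (M : Matrix ι ι ℂ) (w : κ → ℂ) :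
    star w ⬝ᵥ ((A * M * Aᴴ) *ᵥ w) = star (Aᴴ *ᵥ w) ⬝ᵥ (M *ᵥ (Aᴴ *ᵥ w)) := by
  rw [star_mulVec, conjTranspose_conjTranspose, ← dotProduct_mulVec, mulVec_mulVec, mulVec_mulVec]

lemma posDef_add_smul_vecMulVec_star {M : Matrix ι ι ℂ} (hM : M.PosDef) {ρ : ℝ} (hρ : 0 ≤ ρ)
    (u : ι → ℂ) : (M + (ρ : ℂ) • vecMulVec u (star u)).PosDef :=
  hM.add_posSemidef ((posSemidef_vecMulVec_self_star u).smul (by exact_mod_cast hρ))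

variable [DecidableEq ι]

/-- The matrix determinant lemma for a rank-one update. -/
lemma det_add_smul_vecMulVec {M : Matrix ι ι ℂ} (hM : IsUnit M.det) (c : ℂ) (u v : ι → ℂ) :
    (M + c • vecMulVec u v).det = M.det * (1 + c * (v ⬝ᵥ (M⁻¹ *ᵥ u))) := by
  rw [← smul_vecMulVec, vecMulVec_eq Unit, det_add_replicateCol_mul_replicateRow hM,
    det_unique (n := Unit), Matrix.mul_assoc, ← replicateCol_mulVec, Matrix.add_apply,
    replicateRow_mul_replicateCol_apply, mulVec_smul, dotProduct_smul, one_apply_eq, smul_eq_mul]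

variable {ρ : ℝ} {Q : ℕ → Matrix ι ι ℂ}

lemma posDef_of_rankOne_updates (hρ : 0 ≤ ρ) (hQ0 : Q 0 = 1) {N : ℕ} (u : Fin N → ι → ℂ)
    (hQ : ∀ n : Fin N, Q (n.val + 1) = Q n.val + (ρ : ℂ) • vecMulVec (u n) (star (u n)))
    {k : ℕ} (hk : k ≤ N) : (Q k).PosDef := by
  induction k with
  | zero => exact hQ0 ▸ PosDef.one
  | succ k ih =>
    rw [hQ ⟨k, hk⟩]
    exact posDef_add_smul_vecMulVec_star (ih (by omega)) hρ _

lemma det_eq_prod_of_rankOne_updates (hρ : 0 ≤ ρ) (hQ0 : Q 0 = 1) {N : ℕ} (u : Fin N → ι → ℂ)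
    (hQ : ∀ n : Fin N, Q (n.val + 1) = Q n.val + (ρ : ℂ) • vecMulVec (u n) (star (u n))) :
    (Q N).det = ∏ n : Fin N, (1 + ρ * (star (u n) ⬝ᵥ ((Q n.val)⁻¹ *ᵥ u n))) := by
  induction N with
  | zero => simp [hQ0]
  | succ N ih =>
    have hunit : IsUnit (Q N).det :=
      (posDef_of_rankOne_updates hρ hQ0 u hQ N.le_succ).det_pos.ne'.isUnit
    have hlast := hQ (Fin.last N)
    rw [Fin.val_last] at hlast
    rw [hlast, det_add_smul_vecMulVec hunit,
      ih (fun n => u n.castSucc) fun n => hQ n.castSucc, Fin.prod_univ_castSucc]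
    rfl

end RankOneUpdates

/-- (Lemma 1.) With `G n = (H n)ᴴ w_n w_nᴴ (H n)`, `Q 0 = I_K`,
`Q (n+1) = Q n + ρ G n` and `T n = H n (Q n)⁻¹ (H n)ᴴ` (0-based indexing):
each scalar `wₙᴴ (T n) wₙ` is a nonnegative real number, `det(I_K + ρ ∑ₙ G n)` is a
real number `≥ 1`, and the total achievable rate factorizes into the sum of
sub-rates: `log₂ Re(det(I_K + ρ ∑ₙ G n)) = ∑ₙ log₂(1 + ρ Re(wₙᴴ (T n) wₙ))`. -/
theorem stmt4 {K N : ℕ} (ρ : ℝ) (hρ : 0 < ρ) (m : Fin N → ℕ)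
    (H : (n : Fin N) → Matrix (Fin (m n)) (Fin K) ℂ)
    (w : (n : Fin N) → Fin (m n) → ℂ)
    (Q : ℕ → Matrix (Fin K) (Fin K) ℂ)
    (hQ0 : Q 0 = 1)
    (hQ : ∀ n : Fin N, Q (n.val + 1) =
      Q n.val + (ρ : ℂ) • ((H n)ᴴ * Matrix.vecMulVec (w n) (star (w n)) * H n)) :
    (∀ n : Fin N,
      (star (w n) ⬝ᵥ ((H n * (Q n.val)⁻¹ * (H n)ᴴ) *ᵥ w n)).im = 0 ∧
      0 ≤ (star (w n) ⬝ᵥ ((H n * (Q n.val)⁻¹ * (H n)ᴴ) *ᵥ w n)).re) ∧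
    (Matrix.det
        (1 + (ρ : ℂ) •
          ∑ n : Fin N, (H n)ᴴ * Matrix.vecMulVec (w n) (star (w n)) * H n)).im = 0 ∧
    1 ≤ (Matrix.det
        (1 + (ρ : ℂ) •
          ∑ n : Fin N, (H n)ᴴ * Matrix.vecMulVec (w n) (star (w n)) * H n)).re ∧
    Real.logb 2
        (Matrix.det
          (1 + (ρ : ℂ) •
            ∑ n : Fin N, (H n)ᴴ * Matrix.vecMulVec (w n) (star (w n)) * H n)).re =
      ∑ n : Fin N,
        Real.logb 2
          (1 + ρ * (star (w n) ⬝ᵥ ((H n * (Q n.val)⁻¹ * (H n)ᴴ) *ᵥ w n)).re) := by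
  simp only [star_dotProduct_mul_mul_conjTranspose_mulVec, conjTranspose_mul_vecMulVec_star_mul]
    at hQ ⊢
  set u : Fin N → Fin K → ℂ := fun n => (H n)ᴴ *ᵥ w n
  have hs (n : Fin N) : 0 ≤ star (u n) ⬝ᵥ ((Q n.val)⁻¹ *ᵥ u n) :=
    (posDef_of_rankOne_updates hρ.le hQ0 u hQ n.isLt.le).inv.posSemidef.dotProduct_mulVec_nonneg _
  have hre (n : Fin N) : 0 ≤ (star (u n) ⬝ᵥ ((Q n.val)⁻¹ *ᵥ u n)).re :=
    (Complex.le_def.mp (hs n)).1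
  have him (n : Fin N) : (star (u n) ⬝ᵥ ((Q n.val)⁻¹ *ᵥ u n)).im = 0 :=
    (Complex.le_def.mp (hs n)).2.symm
  have hdet : (1 + (ρ : ℂ) • ∑ n, vecMulVec (u n) (star (u n))).det =
      ((∏ n : Fin N, (1 + ρ * (star (u n) ⬝ᵥ ((Q n.val)⁻¹ *ᵥ u n)).re) : ℝ) : ℂ) := by
    rw [← eq_one_add_sum_of_rankOne_updates hQ0 u hQ, det_eq_prod_of_rankOne_updates hρ.le hQ0 u hQ]
    push_cast
    refine Finset.prod_congr rfl fun n _ => ?_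
    rw [Complex.ext (Complex.ofReal_re _) ((Complex.ofReal_im _).trans (him n).symm)]
  have hfactor (n : Fin N) : 1 ≤ 1 + ρ * (star (u n) ⬝ᵥ ((Q n.val)⁻¹ *ᵥ u n)).re :=
    le_add_of_nonneg_right (mul_nonneg hρ.le (hre n))
  refine ⟨fun n => ⟨him n, hre n⟩, ?_⟩
  rw [hdet, Complex.ofReal_im, Complex.ofReal_re]
  refine ⟨rfl, Finset.one_le_prod fun n _ => hfactor n, ?_⟩
  exact Real.logb_prod _ _ fun n _ => (zero_lt_one.trans_le (hfactor n)).ne'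
end

section
/- (Lemma 2, exact-orthogonality version.) Let ρ > 0, let M, K, N be positive integers, and for n = 1,…,N let H_n ∈ ℂ^{M×K} satisfy H_n^H H_n = M · I_K, and let w_n ∈ ℂ^{M} satisfy H_n^H w_n ≠ 0. Define G_n = H_n^H w_n w_n^H H_n, Q_0 = I_K, Q_n = Q_{n−1} + ρ G_n, and T_n = H_n Q_{n−1}^{−1} H_n^H. Then Re(tr(T_n)) = M · Re(tr(Q_{n−1}^{−1})) for every n, and Re(tr(T_{n+1})) < Re(tr(T_n)) for every n ∈ {1,…,N−1}; that is, tr(T_n) is strictly decreasing in n. -/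
open Matrix
open scoped ComplexOrder

/-- A positive rank-one update of a positive definite matrix strictly decreases the trace of its
inverse. -/
theorem trace_inv_add_smul_vecMulVec_lt {m : Type*} [Fintype m] [DecidableEq m]
    {A : Matrix m m ℂ} (hA : A.PosDef) {v : m → ℂ} (hv : v ≠ 0) {r : ℝ} (hr : 0 < r) :
    (A + (r : ℂ) • vecMulVec v (star v))⁻¹.trace < A⁻¹.trace := by
  have hr' : (0 : ℂ) < r := by exact_mod_cast hr
  have hB : (A + (r : ℂ) • vecMulVec v (star v)).PosDef :=
    hA.add_posSemidef ((posSemidef_vecMulVec_self_star v).smul hr'.le)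
  set B := A + (r : ℂ) • vecMulVec v (star v) with hBdef
  have hAu : IsUnit A.det := (isUnit_iff_isUnit_det A).1 hA.isUnit
  have hBu : IsUnit B.det := (isUnit_iff_isUnit_det B).1 hB.isUnit
  set u := A⁻¹ *ᵥ v with hu
  set c := star v ⬝ᵥ u with hc
  have hc0 : 0 ≤ c := hA.inv.posSemidef.dotProduct_mulVec_nonneg v
  have hk : 0 < 1 + (r : ℂ) * c := add_pos_of_pos_of_nonneg one_pos (mul_nonneg hr'.le hc0)
  have hAuv : A *ᵥ u = v := by
    rw [hu, mulVec_mulVec, mul_nonsing_inv _ hAu, one_mulVec]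
  have hu0 : u ≠ 0 := by
    intro h
    rw [h, mulVec_zero] at hAuv
    exact hv hAuv.symm
  have hBuv : B *ᵥ u = (1 + (r : ℂ) * c) • v := by
    rw [hBdef, add_mulVec, smul_mulVec, vecMulVec_mulVec, hAuv, ← hc]
    ext i
    simp
    ring
  have hBv : u = (1 + (r : ℂ) * c) • (B⁻¹ *ᵥ v) := by
    rw [← mulVec_smul, ← hBuv, mulVec_mulVec, nonsing_inv_mul _ hBu, one_mulVec]
  have hdiff : A⁻¹ - B⁻¹ = (r : ℂ) • vecMulVec (B⁻¹ *ᵥ v) (star u) := by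
    have h1 : A⁻¹ - B⁻¹ = B⁻¹ * (B - A) * A⁻¹ := by
      rw [mul_sub, sub_mul, nonsing_inv_mul _ hBu, one_mul, mul_assoc, mul_nonsing_inv _ hAu,
        mul_one]
    rw [h1, hBdef, add_sub_cancel_left, ← hBdef, Matrix.mul_smul, Matrix.smul_mul, mul_vecMulVec,
      vecMulVec_mul, hu, star_mulVec, hA.inv.isHermitian.eq]
  have htr : A⁻¹.trace - B⁻¹.trace = (r : ℂ) * (1 + (r : ℂ) * c)⁻¹ * (u ⬝ᵥ star u) := by
    have hBv' : B⁻¹ *ᵥ v = (1 + (r : ℂ) * c)⁻¹ • u := by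
      rw [hBv, inv_smul_smul₀ hk.ne']
    rw [← trace_sub, hdiff, trace_smul, trace_vecMulVec, hBv', smul_dotProduct, smul_eq_mul,
      smul_eq_mul, mul_assoc]
  rw [← sub_pos, htr]
  exact mul_pos (mul_pos hr' (RCLike.inv_pos_of_pos hk)) (dotProduct_self_star_pos_iff.2 hu0)

/-- (Lemma 2, exact-orthogonality version.) Let `ρ > 0`, let
`M, K, N` be positive, and for each `n` let `H n ∈ ℂ^{M×K}` satisfy
`(H n)ᴴ (H n) = M I_K` and `w n ∈ ℂ^M` satisfy `(H n)ᴴ w n ≠ 0`. With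
`G n = (H n)ᴴ w_n w_nᴴ (H n)`, `Q 0 = I_K`, `Q (n+1) = Q n + ρ G n` and
`T n = H n (Q n)⁻¹ (H n)ᴴ` (0-based indexing), one has
`Re(tr (T n)) = M Re(tr (Q n)⁻¹)` for every `n`, and
`Re(tr (T (n+1))) < Re(tr (T n))`, i.e. `tr (T n)` is strictly decreasing. -/
theorem stmt11 {M K N : ℕ} (ρ : ℝ) (hρ : 0 < ρ)
    (hM : 0 < M) (hK : 0 < K) (hN : 0 < N)
    (H : Fin N → Matrix (Fin M) (Fin K) ℂ)
    (hH : ∀ n, (H n)ᴴ * H n = (M : ℂ) • (1 : Matrix (Fin K) (Fin K) ℂ))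
    (w : Fin N → Fin M → ℂ)
    (hw : ∀ n, (H n)ᴴ *ᵥ w n ≠ 0)
    (Q : ℕ → Matrix (Fin K) (Fin K) ℂ)
    (hQ0 : Q 0 = 1)
    (hQ : ∀ n : Fin N, Q (n.val + 1) =
      Q n.val + (ρ : ℂ) • ((H n)ᴴ * Matrix.vecMulVec (w n) (star (w n)) * H n)) :
    (∀ n : Fin N,
      (Matrix.trace (H n * (Q n.val)⁻¹ * (H n)ᴴ)).re =
        M * (Matrix.trace (Q n.val)⁻¹).re) ∧
    (∀ (n : Fin N) (h : n.val + 1 < N),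
      (Matrix.trace (H ⟨n.val + 1, h⟩ * (Q (n.val + 1))⁻¹ * (H ⟨n.val + 1, h⟩)ᴴ)).re <
        (Matrix.trace (H n * (Q n.val)⁻¹ * (H n)ᴴ)).re) := by
  have hG (n : Fin N) : Q (n.val + 1) =
      Q n.val + (ρ : ℂ) • vecMulVec ((H n)ᴴ *ᵥ w n) (star ((H n)ᴴ *ᵥ w n)) := by
    rw [hQ n, mul_vecMulVec, vecMulVec_mul, star_mulVec, conjTranspose_conjTranspose]
  have hρ' : (0 : ℂ) ≤ ρ := by exact_mod_cast hρ.le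
  have hpos (n : ℕ) (hn : n ≤ N) : (Q n).PosDef := by
    induction n with
    | zero => exact hQ0 ▸ PosDef.one
    | succ n ih =>
      rw [hG ⟨n, hn⟩]
      exact (ih (by lia)).add_posSemidef ((posSemidef_vecMulVec_self_star _).smul hρ')
  have htr (n : Fin N) (X : Matrix (Fin K) (Fin K) ℂ) :
      (trace (H n * X * (H n)ᴴ)).re = M * (trace X).re := by
    rw [trace_mul_comm, ← Matrix.mul_assoc, hH n, Matrix.smul_mul, Matrix.one_mul, trace_smul]
    simp
  refine ⟨fun n => htr n _, fun n h => ?_⟩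
  rw [htr, htr, hG n]
  have hlt := trace_inv_add_smul_vecMulVec_lt (hpos n.val n.isLt.le) (hw n) hρ
  exact mul_lt_mul_of_pos_left (Complex.lt_def.1 hlt).1 (by exact_mod_cast hM)
end

section
/- (Each trace decrement is less than one.) Let Q ∈ ℂ^{K×K} be Hermitian positive definite with Q − I_K positive semidefinite, let ρ > 0, and let a ∈ ℂ^K. Then Re(tr(Q^{−1})) − Re(tr((Q + ρ a a^H)^{−1})) < 1. -/
open Matrix
open scoped ComplexOrder

/-- The **Sherman–Morrison formula** for a Hermitian rank-one update. -/
theorem Matrix.inv_add_smul_vecMulVec_star {n R : Type*} [Fintype n] [DecidableEq n]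
    [Field R] [StarRing R] {Q : Matrix n n R} (hQ : Q.IsHermitian) (hdet : IsUnit Q.det)
    {a v : n → R} (hv : Q *ᵥ v = a) {r : R} (hr : 1 + r * (star a ⬝ᵥ v) ≠ 0) :
    (Q + r • vecMulVec a (star a))⁻¹ =
      Q⁻¹ - (r / (1 + r * (star a ⬝ᵥ v))) • vecMulVec v (star v) := by
  have hrow : star a ᵥ* Q⁻¹ = star v := by
    rw [← hv, star_mulVec, hQ.eq, vecMul_vecMul, mul_nonsing_inv Q hdet, vecMul_one]
  apply inv_eq_right_inv
  rw [add_mul, mul_sub, mul_sub, mul_nonsing_inv Q hdet, Matrix.mul_smul, mul_vecMulVec, hv,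
    Matrix.smul_mul, vecMulVec_mul, hrow, Matrix.smul_mul, Matrix.mul_smul, vecMulVec_mul_vecMulVec]
  ext i j
  simp only [Matrix.add_apply, Matrix.sub_apply, Matrix.smul_apply, vecMulVec_apply, smul_eq_mul,
    Pi.smul_apply]
  field_simp
  ring

/-- (Each trace decrement is less than one.) If `Q ∈ ℂ^{K×K}` is
Hermitian positive definite with `Q − I_K` positive semidefinite, `ρ > 0` and
`a ∈ ℂ^K`, then `Re(tr Q⁻¹) − Re(tr (Q + ρ a aᴴ)⁻¹) < 1`. -/
theorem stmt14 {K : ℕ} (Q : Matrix (Fin K) (Fin K) ℂ)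
    (hQ : Q.PosDef) (hQ1 : (Q - 1).PosSemidef)
    (ρ : ℝ) (hρ : 0 < ρ) (a : Fin K → ℂ) :
    (Matrix.trace Q⁻¹).re -
        (Matrix.trace (Q + (ρ : ℂ) • Matrix.vecMulVec a (star a))⁻¹).re < 1 := by
  have hdet : IsUnit Q.det := (isUnit_iff_isUnit_det Q).mp hQ.isUnit
  obtain ⟨v, hv⟩ : ∃ v, Q *ᵥ v = a :=
    ⟨Q⁻¹ *ᵥ a, by rw [mulVec_mulVec, mul_nonsing_inv Q hdet, one_mulVec]⟩
  have hs : star a ⬝ᵥ v = star v ⬝ᵥ (Q *ᵥ v) := by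
    rw [← hv, star_mulVec, hQ.isHermitian.eq, dotProduct_mulVec]
  have hs0 : 0 ≤ star a ⬝ᵥ v := hs ▸ hQ.posSemidef.dotProduct_mulVec_nonneg v
  have ht0 : 0 ≤ v ⬝ᵥ star v := dotProduct_self_star_nonneg v
  have hle : v ⬝ᵥ star v ≤ star a ⬝ᵥ v := by
    have h := hQ1.dotProduct_mulVec_nonneg v
    rwa [sub_mulVec, one_mulVec, dotProduct_sub, ← hs, dotProduct_comm (star v) v,
      sub_nonneg] at h
  obtain ⟨s, hs'⟩ : ∃ s : ℝ, (s : ℂ) = star a ⬝ᵥ v := ⟨_, (Complex.eq_re_of_ofReal_le hs0).symm⟩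
  obtain ⟨t, ht'⟩ : ∃ t : ℝ, (t : ℂ) = v ⬝ᵥ star v := ⟨_, (Complex.eq_re_of_ofReal_le ht0).symm⟩
  rw [← hs'] at hs0 hle
  rw [← ht'] at hle
  have hs0 : 0 ≤ s := by exact_mod_cast hs0
  have hle : t ≤ s := by exact_mod_cast hle
  have hpos : 0 < 1 + ρ * s := by positivity
  have hr : 1 + (ρ : ℂ) * (star a ⬝ᵥ v) ≠ 0 := by
    rw [← hs']
    exact_mod_cast hpos.ne'
  rw [inv_add_smul_vecMulVec_star hQ.isHermitian hdet hv hr, trace_sub, trace_smul,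
    trace_vecMulVec, ← hs', ← ht', Complex.sub_re, sub_sub_cancel, smul_eq_mul]
  have hcast : (ρ : ℂ) / (1 + ρ * s) * t = ((ρ / (1 + ρ * s) * t : ℝ) : ℂ) := by push_cast; rfl
  rw [hcast, Complex.ofReal_re, div_mul_eq_mul_div, div_lt_one hpos]
  nlinarith
end
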